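/- arXiv:2211.04827 — 3 statements merged into one kernel-verified Lean document; each statement's English description precedes it below -/
import Mathlib

section
/- Suppose sequences (x_k), (γ_k), (α_k), (p_k), (Φ_k) are generated by the nonmonotone proximal gradient method with backtracking information, and assume ∇f is locally Lipschitz continuous (every point of X has a neighborhood on which ∇f is Lipschitz). Let K ⊆ {1, 2, …} be an infinite index set such that the subsequence (x_k)_{k∈K} converges to some x* ∈ X. Then there exists γ_* > 0 with γ_k ≥ γ_* for all k ∈ K, and for every k ≥ 1 with K_k := {j ∈ K : 1 ≤ j ≤ k} nonempty, min_{j∈K_k} ‖x_j − x_{j−1}‖/γ_j ≤ (1/√|K_k|)·( 2·(φ(x_0) − φ_*) / (γ_*·p_min·(1 − α_max)) )^{1/2}, where |K_k| is the cardinality of K_k and φ_* denotes the (existing, finite) limit of the nonincreasing sequence (Φ_k). -/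
open Filter Topology
open scoped RealInnerProductSpace

variable {X : Type*} [NormedAddCommGroup X] [InnerProductSpace ℝ X] [FiniteDimensional ℝ X]

/-- The extended-real-valued composite objective `φ = f + g`. -/
noncomputable def phiE (f : X → ℝ) (g : X → EReal) (z : X) : EReal :=
  (f z : EReal) + g z

/-- `y` minimizes `z ↦ g z + ⟪v, z - x⟫ + ‖z - x‖² / (2γ)` over `X`
(a proximal gradient step from `x` with gradient vector `v` and stepsize `γ`). -/
def ProxMin (g : X → EReal) (v x : X) (γ : ℝ) (y : X) : Prop :=
  ∀ z : X,
    g y + ((⟪v, y - x⟫ + ‖y - x‖ ^ 2 / (2 * γ) : ℝ) : EReal) ≤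
      g z + ((⟪v, z - x⟫ + ‖z - x‖ ^ 2 / (2 * γ) : ℝ) : EReal)

/-- Fréchet (regular) subgradient of `h` at `xb`. -/
noncomputable def FSubgrad (h : X → EReal) (xb v : X) : Prop :=
  h xb ≠ ⊤ ∧
    0 ≤ Filter.liminf
        (fun z : X => (h z - h xb - ((⟪v, z - xb⟫ : ℝ) : EReal)) / ((‖z - xb‖ : ℝ) : EReal))
        (𝓝[≠] xb)

/-- Limiting (Mordukhovich) subgradient of `h` at `xb`. -/
noncomputable def MSubgrad (h : X → EReal) (xb v : X) : Prop :=
  h xb ≠ ⊤ ∧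
    ∃ xs vs : ℕ → X,
      Tendsto xs atTop (𝓝 xb) ∧ Tendsto vs atTop (𝓝 v) ∧
        Tendsto (fun j => h (xs j)) atTop (𝓝 (h xb)) ∧ ∀ j, FSubgrad h (xs j) (vs j)

/-- The sequences `x, γ, α, p, Φ` are generated by the nonmonotone proximal gradient
method for `φ = f + g` with parameters `γmax, αmin, αmax, pmin`. -/
structure NMPG (f : X → ℝ) (g : X → EReal) (γmax αmin αmax pmin : ℝ)
    (x : ℕ → X) (γ α p : ℕ → ℝ) (Φ : ℕ → ℝ) : Prop where
  hf : ContDiff ℝ 1 f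
  hg_nebot : ∀ z, g z ≠ ⊥
  hg_proper : ∃ z, g z ≠ ⊤
  hg_lsc : LowerSemicontinuous g
  hg_proxbdd : ∃ γ₀ : ℝ, 0 < γ₀ ∧ ∃ m : ℝ, ∀ z,
    (m : EReal) ≤ g z + ((‖z‖ ^ 2 / (2 * γ₀) : ℝ) : EReal)
  hφ_bdd : ∃ m : ℝ, ∀ z, (m : EReal) ≤ phiE f g z
  hγmax : 0 < γmax
  hαmin : 0 < αmin
  hαα : αmin ≤ αmax
  hαmax : αmax < 1
  hpmin : 0 < pmin
  hpone : pmin ≤ 1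
  hx0 : g (x 0) ≠ ⊤
  hΦ0 : (Φ 0 : EReal) = phiE f g (x 0)
  hγpos : ∀ k, 0 < γ k
  hγle : ∀ k, γ k ≤ γmax
  hαmem : ∀ k, α k ∈ Set.Icc αmin αmax
  hpmem : ∀ k, p k ∈ Set.Icc pmin 1
  hstep : ∀ k : ℕ, ProxMin g (gradient f (x k)) (x k) (γ (k + 1)) (x (k + 1))
  hls : ∀ k : ℕ, phiE f g (x (k + 1)) ≤
      ((Φ k - (1 - α (k + 1)) / (2 * γ (k + 1)) * ‖x (k + 1) - x k‖ ^ 2 : ℝ) : EReal)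
  hΦrec : ∀ k : ℕ, Φ (k + 1) = (1 - p (k + 1)) * Φ k + p (k + 1) * (phiE f g (x (k + 1))).toReal

/-- Backtracking information: for every `k`, either `γ k ≥ γmin`, or the previously
attempted stepsize `σ ∈ [γ k / βmax, γ k / βmin]` was rejected by the line search. -/
def Backtrack (f : X → ℝ) (g : X → EReal) (αmin γmin βmin βmax : ℝ)
    (x : ℕ → X) (γ : ℕ → ℝ) (Φ : ℕ → ℝ) : Prop :=
  ∀ k : ℕ, γmin ≤ γ (k + 1) ∨
    ∃ σ : ℝ, ∃ y : X, γ (k + 1) / βmax ≤ σ ∧ σ ≤ γ (k + 1) / βmin ∧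
      ProxMin g (gradient f (x k)) (x k) σ y ∧
      ((Φ k - (1 - αmin) / (2 * σ) * ‖y - x k‖ ^ 2 : ℝ) : EReal) < phiE f g y

omit [NormedAddCommGroup X] [InnerProductSpace ℝ X] [FiniteDimensional ℝ X] in
lemma phiE_eq_coe {f : X → ℝ} {g : X → EReal} {z : X} (hb : g z ≠ ⊥) (ht : g z ≠ ⊤) :
    phiE f g z = ((f z + (g z).toReal : ℝ) : EReal) := by
  rw [phiE, EReal.coe_add, EReal.coe_toReal ht hb]

omit [FiniteDimensional ℝ X] in
/-- A proximal step from a point of the domain of `g` stays in the domain and does not increase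
the proximal model. -/
lemma ProxMin.le_self {g : X → EReal} {v x y : X} {σ : ℝ} (h : ProxMin g v x σ y)
    (hb : ∀ z, g z ≠ ⊥) (hx : g x ≠ ⊤) :
    g y ≠ ⊤ ∧ (g y).toReal + ⟪v, y - x⟫ + ‖y - x‖ ^ 2 / (2 * σ) ≤ (g x).toReal := by
  have h1 := h x
  simp only [sub_self, inner_zero_right, norm_zero] at h1
  norm_num at h1
  have hy : g y ≠ ⊤ := by
    intro hy
    rw [hy, ← EReal.coe_add, EReal.top_add_coe] at h1
    exact hx (top_le_iff.mp h1)
  refine ⟨hy, ?_⟩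
  rw [← EReal.coe_toReal hy (hb y), ← EReal.coe_toReal hx (hb x)] at h1
  rw [add_assoc]
  exact_mod_cast h1

omit [FiniteDimensional ℝ X] in
lemma norm_sub_lt_of_prox_bound {γ₀ : ℝ} (hγ₀ : 0 < γ₀) (m G V R : ℝ) {s : ℝ} (hs : 0 < s) :
    ∃ δ : ℝ, 0 < δ ∧ ∀ (gx gy σ : ℝ) (v x y : X), 0 < σ → σ < δ → gx ≤ G →
      m ≤ gy + ‖y‖ ^ 2 / (2 * γ₀) → ‖v‖ ≤ V → ‖x‖ ≤ R →
      gy + ⟪v, y - x⟫ + ‖y - x‖ ^ 2 / (2 * σ) ≤ gx → ‖y - x‖ < s := by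
  set C : ℝ := |G - m| + V ^ 2 / 2 + R ^ 2 / γ₀ with hC
  have hC0 : 0 ≤ C := by positivity
  set B : ℝ := 1 / γ₀ + 1 / 2 + (C + 1) / s ^ 2 with hB
  have hB0 : 0 < B := by positivity
  refine ⟨1 / (2 * B), by positivity, ?_⟩
  intro gx gy σ v x y hσ hσδ hgx hgy hv hx hle
  by_contra! hst
  set t := ‖y - x‖ with ht
  have ht0 : 0 ≤ t := norm_nonneg _
  have hV0 : 0 ≤ V := (norm_nonneg v).trans hv
  have hσB : B ≤ 1 / (2 * σ) := by
    rw [lt_div_iff₀ (by positivity)] at hσδ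
    rw [le_div_iff₀ (by positivity)]
    nlinarith
  have hin : -(V * t) ≤ ⟪v, y - x⟫ := by
    have h1 := abs_le.mp (abs_real_inner_le_norm v (y - x))
    have h2 : ‖v‖ * ‖y - x‖ ≤ V * t := by gcongr
    linarith [h1.1]
  have hy : ‖y‖ ^ 2 ≤ 2 * R ^ 2 + 2 * t ^ 2 := by
    have h1 : ‖y‖ ≤ R + t := by
      have h2 := norm_add_le x (y - x)
      rw [add_sub_cancel] at h2
      linarith
    have h3 : ‖y‖ ^ 2 ≤ (R + t) ^ 2 := by gcongr
    nlinarith [sq_nonneg (R - t)]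
  have hy' : ‖y‖ ^ 2 / (2 * γ₀) ≤ R ^ 2 / γ₀ + t ^ 2 * (1 / γ₀) := by
    calc ‖y‖ ^ 2 / (2 * γ₀) ≤ (2 * R ^ 2 + 2 * t ^ 2) / (2 * γ₀) := by gcongr
      _ = _ := by field_simp
  have h1 : t ^ 2 * B ≤ t ^ 2 / (2 * σ) := by
    rw [div_eq_mul_one_div]
    gcongr
  have h2 : C + 1 ≤ t ^ 2 * ((C + 1) / s ^ 2) := by
    rw [mul_div_assoc', le_div_iff₀ (by positivity), mul_comm]
    gcongr
  have h3 : t ^ 2 * B = t ^ 2 * (1 / γ₀) + t ^ 2 * (1 / 2) + t ^ 2 * ((C + 1) / s ^ 2) := by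
    rw [hB]; ring
  have h4 : V * t ≤ V ^ 2 / 2 + t ^ 2 * (1 / 2) := by nlinarith [sq_nonneg (V - t)]
  linarith [le_abs_self (G - m)]

lemma le_add_inner_gradient_add_of_lipschitzOnWith {f : X → ℝ} (hf : Differentiable ℝ f)
    {L : NNReal} {c : X} {r : ℝ} (hL : LipschitzOnWith L (gradient f) (Metric.ball c r)) {x y : X}
    (hx : x ∈ Metric.ball c r) (hy : y ∈ Metric.ball c r) :
    f y ≤ f x + ⟪gradient f x, y - x⟫ + L * ‖y - x‖ ^ 2 := by
  have hsub : segment ℝ x y ⊆ Metric.ball c r := (convex_ball c r).segment_subset hx hy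
  have key := Convex.norm_image_sub_le_of_norm_hasFDerivWithin_le' (𝕜 := ℝ) (f := f)
    (f' := fderiv ℝ f) (C := L * ‖y - x‖) (φ := fderiv ℝ f x)
    (fun z _ => (hf z).hasFDerivAt.hasFDerivWithinAt) ?_ (convex_segment x y)
    (left_mem_segment ℝ x y) (right_mem_segment ℝ x y)
  · have h1 := (abs_le.mp (Real.norm_eq_abs _ ▸ key)).2
    have h2 : fderiv ℝ f x (y - x) = ⟪gradient f x, y - x⟫ := by
      simp [gradient]
    rw [h2] at h1
    nlinarith
  · intro z hz
    have h1 : ‖fderiv ℝ f z - fderiv ℝ f x‖ = ‖gradient f z - gradient f x‖ := by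
      rw [gradient, gradient, ← map_sub, LinearIsometryEquiv.norm_map]
    rw [h1]
    refine (hL.norm_sub_le (hsub hz) hx).trans ?_
    gcongr
    have := norm_sub_le_of_mem_segment hz
    simpa using this

namespace NMPG

variable {f : X → ℝ} {g : X → EReal} {γmax αmin αmax pmin : ℝ}
  {x : ℕ → X} {γ α p Φ : ℕ → ℝ}

lemma g_ne_top (h : NMPG f g γmax αmin αmax pmin x γ α p Φ) (k : ℕ) : g (x k) ≠ ⊤ := by
  induction k with
  | zero => exact h.hx0
  | succ k ih => exact ((h.hstep k).le_self h.hg_nebot ih).1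

lemma merit_zero (h : NMPG f g γmax αmin αmax pmin x γ α p Φ) :
    Φ 0 = f (x 0) + (g (x 0)).toReal := by
  have := h.hΦ0
  rw [phiE_eq_coe (h.hg_nebot _) h.hx0] at this
  exact_mod_cast this

lemma line_search (h : NMPG f g γmax αmin αmax pmin x γ α p Φ) (k : ℕ) :
    f (x (k + 1)) + (g (x (k + 1))).toReal ≤
      Φ k - (1 - αmax) / (2 * γ (k + 1)) * ‖x (k + 1) - x k‖ ^ 2 := by
  have h1 := h.hls k
  rw [phiE_eq_coe (h.hg_nebot _) (h.g_ne_top _), EReal.coe_le_coe_iff] at h1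
  have hγ := h.hγpos (k + 1)
  have hα := (h.hαmem (k + 1)).2
  have h2 : (1 - αmax) / (2 * γ (k + 1)) * ‖x (k + 1) - x k‖ ^ 2 ≤
      (1 - α (k + 1)) / (2 * γ (k + 1)) * ‖x (k + 1) - x k‖ ^ 2 := by gcongr
  linarith

lemma decrease_nonneg (h : NMPG f g γmax αmin αmax pmin x γ α p Φ) (k : ℕ) :
    0 ≤ (1 - αmax) / (2 * γ (k + 1)) * ‖x (k + 1) - x k‖ ^ 2 := by
  have hγ := h.hγpos (k + 1)
  have hα : 0 ≤ 1 - αmax := by linarith [h.hαmax]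
  positivity

lemma merit_succ (h : NMPG f g γmax αmin αmax pmin x γ α p Φ) (k : ℕ) :
    Φ (k + 1) = (1 - p (k + 1)) * Φ k +
      p (k + 1) * (f (x (k + 1)) + (g (x (k + 1))).toReal) := by
  rw [h.hΦrec, phiE_eq_coe (h.hg_nebot _) (h.g_ne_top _), EReal.toReal_coe]

lemma objective_le_merit (h : NMPG f g γmax αmin αmax pmin x γ α p Φ) (k : ℕ) :
    f (x k) + (g (x k)).toReal ≤ Φ k := by
  cases k with
  | zero => exact h.merit_zero.ge
  | succ k =>
    rw [h.merit_succ k]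
    nlinarith [(h.hpmem (k + 1)).2, h.line_search k, h.decrease_nonneg k]

lemma sufficient_decrease (h : NMPG f g γmax αmin αmax pmin x γ α p Φ) (k : ℕ) :
    pmin * ((1 - αmax) / (2 * γ (k + 1)) * ‖x (k + 1) - x k‖ ^ 2) ≤ Φ k - Φ (k + 1) := by
  have h1 := h.line_search k
  have h2 := h.decrease_nonneg k
  have h3 := (h.hpmem (k + 1)).1
  calc pmin * ((1 - αmax) / (2 * γ (k + 1)) * ‖x (k + 1) - x k‖ ^ 2)
      ≤ p (k + 1) * (Φ k - (f (x (k + 1)) + (g (x (k + 1))).toReal)) := by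
        gcongr
        · exact h.hpmin.le.trans h3
        · linarith
    _ = _ := by rw [h.merit_succ k]; ring

lemma merit_antitone (h : NMPG f g γmax αmin αmax pmin x γ α p Φ) : Antitone Φ :=
  antitone_nat_of_succ_le fun k => by
    have := mul_nonneg h.hpmin.le (h.decrease_nonneg k)
    linarith [h.sufficient_decrease k]

lemma tendsto_norm_sub (h : NMPG f g γmax αmin αmax pmin x γ α p Φ) {φstar : ℝ}
    (hΦ : Tendsto Φ atTop (𝓝 φstar)) :
    Tendsto (fun k => ‖x (k + 1) - x k‖) atTop (𝓝 0) := by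
  have hα : 0 < 1 - αmax := by linarith [h.hαmax]
  have hc : 0 < pmin * ((1 - αmax) / (2 * γmax)) := by
    have := h.hpmin
    have := h.hγmax
    positivity
  have hlim : Tendsto (fun k => (Φ k - Φ (k + 1)) / (pmin * ((1 - αmax) / (2 * γmax))))
      atTop (𝓝 0) := by
    have := (hΦ.sub (hΦ.comp (tendsto_add_atTop_nat 1))).div_const
      (pmin * ((1 - αmax) / (2 * γmax)))
    simpa using this
  have hsq : Tendsto (fun k => ‖x (k + 1) - x k‖ ^ 2) atTop (𝓝 0) := by
    refine squeeze_zero (fun k => by positivity) (fun k => ?_) hlim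
    rw [le_div_iff₀ hc]
    refine le_trans ?_ (h.sufficient_decrease k)
    have := h.hpmin.le
    have := h.hγpos (k + 1)
    have := h.hγle (k + 1)
    calc ‖x (k + 1) - x k‖ ^ 2 * (pmin * ((1 - αmax) / (2 * γmax)))
        = pmin * ((1 - αmax) / (2 * γmax) * ‖x (k + 1) - x k‖ ^ 2) := by ring
      _ ≤ _ := by gcongr
  have := hsq.sqrt
  simpa using this

/-- Near any point, small stepsizes are always accepted by the line search. -/
lemma eventually_accepted (h : NMPG f g γmax αmin αmax pmin x γ α p Φ)
    (hLip : LocallyLipschitz (gradient f)) (c : X) :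
    ∃ δ : ℝ, 0 < δ ∧ ∃ ρ : ℝ, 0 < ρ ∧ ∀ (k : ℕ) (σ : ℝ) (y : X), ‖x k - c‖ < ρ → 0 < σ → σ < δ →
      ProxMin g (gradient f (x k)) (x k) σ y →
      phiE f g y ≤ ((Φ k - (1 - αmin) / (2 * σ) * ‖y - x k‖ ^ 2 : ℝ) : EReal) := by
  obtain ⟨L, t, ht, hL⟩ := hLip c
  obtain ⟨r, hr, hrt⟩ := Metric.mem_nhds_iff.mp ht
  replace hL := hL.mono hrt
  have hev : ∀ᶠ z in 𝓝 c, ‖gradient f z‖ < ‖gradient f c‖ + 1 ∧ f c - 1 < f z :=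
    ((hLip.continuous.norm.tendsto c).eventually_lt_const (by linarith)).and
      ((h.hf.continuous.tendsto c).eventually_const_lt (by linarith))
  obtain ⟨ε, hε, hball⟩ := Metric.eventually_nhds_iff.mp hev
  obtain ⟨γ₀, hγ₀, m, hm⟩ := h.hg_proxbdd
  obtain ⟨δ, hδ, hclose⟩ := norm_sub_lt_of_prox_bound (X := X) hγ₀ m (Φ 0 - f c + 1)
    (‖gradient f c‖ + 1) (‖c‖ + ε) (half_pos hr)
  have hαmin := h.hαmin
  refine ⟨min δ (αmin / (2 * (L + 1))), by positivity, min ε (r / 2), by positivity, ?_⟩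
  intro k σ y hxk hσ hσδ hprox
  obtain ⟨hgy, hle⟩ := hprox.le_self h.hg_nebot (h.g_ne_top k)
  obtain ⟨hxε, hxr⟩ := lt_min_iff.mp hxk
  obtain ⟨hσ1, hσ2⟩ := lt_min_iff.mp hσδ
  obtain ⟨hgrad, hfk⟩ := hball (by rwa [dist_eq_norm] : dist (x k) c < ε)
  have hobj := h.objective_le_merit k
  have hmy : m ≤ (g y).toReal + ‖y‖ ^ 2 / (2 * γ₀) := by
    have h1 := hm y
    rw [← EReal.coe_toReal hgy (h.hg_nebot y)] at h1
    exact_mod_cast h1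
  have hxn : ‖x k‖ ≤ ‖c‖ + ε := by
    have h1 := norm_add_le c (x k - c)
    rw [add_sub_cancel] at h1
    linarith
  have hyx : ‖y - x k‖ < r / 2 :=
    hclose _ _ σ _ _ _ hσ hσ1 (by linarith [h.merit_antitone (Nat.zero_le k)]) hmy hgrad.le hxn hle
  have hdesc := le_add_inner_gradient_add_of_lipschitzOnWith (h.hf.differentiable (by norm_num)) hL
    (x := x k) (y := y) (by rw [mem_ball_iff_norm]; linarith)
    (by
      rw [mem_ball_iff_norm]
      have h1 := norm_add_le (y - x k) (x k - c)
      rw [sub_add_sub_cancel] at h1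
      linarith)
  rw [phiE_eq_coe (h.hg_nebot y) hgy, EReal.coe_le_coe_iff]
  have hσL : (L : ℝ) ≤ αmin / (2 * σ) := by
    rw [lt_div_iff₀ (by positivity)] at hσ2
    rw [le_div_iff₀ (by positivity)]
    linarith
  have h1 : (L : ℝ) * ‖y - x k‖ ^ 2 ≤ αmin / (2 * σ) * ‖y - x k‖ ^ 2 := by gcongr
  have h2 : (1 - αmin) / (2 * σ) * ‖y - x k‖ ^ 2 =
      ‖y - x k‖ ^ 2 / (2 * σ) - αmin / (2 * σ) * ‖y - x k‖ ^ 2 := by ring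
  linarith

lemma exists_stepsize_lower_bound (h : NMPG f g γmax αmin αmax pmin x γ α p Φ)
    {γmin βmin βmax : ℝ} (hγmin : 0 < γmin) (hβmin : 0 < βmin)
    (hββ : βmin ≤ βmax)
    (hbt : Backtrack f g αmin γmin βmin βmax x γ Φ)
    (hLip : LocallyLipschitz (gradient f))
    {φstar : ℝ} (hΦlim : Tendsto Φ atTop (𝓝 φstar))
    {K : Set ℕ} (hK1 : ∀ j ∈ K, 1 ≤ j)
    {xstar : X} (hconv : Tendsto x (atTop ⊓ 𝓟 K) (𝓝 xstar)) :
    ∃ γstar : ℝ, 0 < γstar ∧ ∀ j ∈ K, γstar ≤ γ j := by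
  obtain ⟨δ, hδ, ρ, hρ, hacc⟩ := h.eventually_accepted hLip xstar
  have h1 : ∀ᶠ j in atTop, j ∈ K → ‖x j - xstar‖ < ρ / 2 := by
    have := hconv.eventually (Metric.ball_mem_nhds xstar (half_pos hρ))
    rw [eventually_inf_principal] at this
    filter_upwards [this] with j hj hjK using mem_ball_iff_norm.mp (hj hjK)
  have h2 : ∀ᶠ k in atTop, ‖x (k + 1) - x k‖ < ρ / 2 :=
    (h.tendsto_norm_sub hΦlim).eventually_lt_const (half_pos hρ)
  obtain ⟨N₁, hN₁⟩ := eventually_atTop.mp h1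
  obtain ⟨N₂, hN₂⟩ := eventually_atTop.mp h2
  set N := max N₁ N₂ with hN
  obtain ⟨i, -, hi⟩ := (Finset.range (N + 1)).exists_min_image γ ⟨0, by simp⟩
  have hγi := h.hγpos i
  refine ⟨min (γ i) (min γmin (βmin * δ)), by positivity, fun j hj => ?_⟩
  rcases lt_or_ge j (N + 1) with hjN | hjN
  · exact (min_le_left _ _).trans (hi j (Finset.mem_range.mpr hjN))
  refine (min_le_right _ _).trans ?_
  obtain ⟨k, rfl⟩ : ∃ k, j = k + 1 := ⟨j - 1, by have := hK1 j hj; omega⟩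
  have hxk : ‖x k - xstar‖ < ρ := by
    have ha := hN₁ (k + 1) (by omega) hj
    have hb := hN₂ k (by omega)
    rw [norm_sub_rev] at hb
    have hc := norm_add_le (x k - x (k + 1)) (x (k + 1) - xstar)
    rw [sub_add_sub_cancel] at hc
    linarith
  rcases hbt k with hk | ⟨σ, y, hσl, hσu, hprox, hrej⟩
  · exact (min_le_left _ _).trans hk
  refine (min_le_right _ _).trans ?_
  by_contra! hlt
  have hσ : 0 < σ := (div_pos (h.hγpos _) (hβmin.trans_le hββ)).trans_le hσl
  have hσδ : σ < δ := hσu.trans_lt (by rwa [div_lt_iff₀' hβmin])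
  exact absurd hrej (hacc k σ y hxk hσ hσδ hprox).not_gt

lemma sum_sq_le (h : NMPG f g γmax αmin αmax pmin x γ α p Φ) {γstar : ℝ} {φstar : ℝ}
    (hγstar : 0 < γstar) (hΦlim : Tendsto Φ atTop (𝓝 φstar)) {k : ℕ} {S : Finset ℕ}
    (hS : S ⊆ Finset.Icc 1 k) (hSγ : ∀ j ∈ S, γstar ≤ γ j) :
    ∑ j ∈ S, (‖x j - x (j - 1)‖ / γ j) ^ 2 ≤
      2 * (f (x 0) + (g (x 0)).toReal - φstar) / (γstar * pmin * (1 - αmax)) := by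
  have hα : 0 < 1 - αmax := by linarith [h.hαmax]
  have hp := h.hpmin
  have hterm : ∀ j ∈ S, (‖x j - x (j - 1)‖ / γ j) ^ 2 * (γstar * pmin * (1 - αmax)) ≤
      2 * (Φ (j - 1) - Φ j) := by
    intro j hj
    obtain ⟨i, rfl⟩ : ∃ i, j = i + 1 :=
      ⟨j - 1, by have := (Finset.mem_Icc.mp (hS hj)).1; omega⟩
    have hγ := h.hγpos (i + 1)
    have h1 := h.sufficient_decrease i
    simp only [Nat.add_sub_cancel]
    calc (‖x (i + 1) - x i‖ / γ (i + 1)) ^ 2 * (γstar * pmin * (1 - αmax))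
        ≤ (‖x (i + 1) - x i‖ / γ (i + 1)) ^ 2 * (γ (i + 1) * pmin * (1 - αmax)) := by
          gcongr
          exact hSγ _ hj
      _ = 2 * (pmin * ((1 - αmax) / (2 * γ (i + 1)) * ‖x (i + 1) - x i‖ ^ 2)) := by
          field_simp
      _ ≤ _ := by linarith
  have htel : ∑ j ∈ Finset.Icc 1 k, (Φ (j - 1) - Φ j) = Φ 0 - Φ k := by
    rw [← Finset.sum_range_sub' Φ k, Finset.range_eq_Ico]
    exact (Finset.sum_Ico_add' (fun j => Φ (j - 1) - Φ j) 0 k 1).symm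
  rw [le_div_iff₀ (by positivity), Finset.sum_mul, ← h.merit_zero]
  calc _ ≤ ∑ j ∈ S, 2 * (Φ (j - 1) - Φ j) := Finset.sum_le_sum hterm
    _ ≤ ∑ j ∈ Finset.Icc 1 k, 2 * (Φ (j - 1) - Φ j) :=
        Finset.sum_le_sum_of_subset_of_nonneg hS fun j _ _ => by
          linarith [h.merit_antitone (Nat.sub_le j 1)]
    _ = 2 * (Φ 0 - Φ k) := by rw [← Finset.mul_sum, htel]
    _ ≤ _ := by linarith [h.merit_antitone.le_of_tendsto hΦlim k]

end NMPG

lemma exists_le_of_sum_sq_le {ι : Type*} {S : Finset ι} (hS : S.Nonempty) (a : ι → ℝ) {D : ℝ}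
    (h : ∑ j ∈ S, a j ^ 2 ≤ D) :
    ∃ j ∈ S, a j ≤ 1 / Real.sqrt S.card * Real.sqrt D := by
  by_contra! hlt
  have hcard : (0 : ℝ) < S.card := by exact_mod_cast hS.card_pos
  have hD : 0 ≤ D := (Finset.sum_nonneg fun j _ => sq_nonneg (a j)).trans h
  have h1 : ∑ _j ∈ S, D / S.card < ∑ j ∈ S, a j ^ 2 := by
    refine Finset.sum_lt_sum_of_nonempty hS fun j hj => ?_
    have h2 := pow_lt_pow_left₀ (hlt j hj) (by positivity) two_ne_zero
    rw [mul_pow, div_pow, Real.sq_sqrt hcard.le, Real.sq_sqrt hD] at h2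
    calc D / S.card = 1 ^ 2 / S.card * D := by ring
      _ < _ := h2
  rw [Finset.sum_const, nsmul_eq_mul, mul_div_cancel₀ _ hcard.ne'] at h1
  linarith

theorem stmt_12 (f : X → ℝ) (g : X → EReal) (γmax αmin αmax pmin : ℝ)
    (x : ℕ → X) (γ α p : ℕ → ℝ) (Φ : ℕ → ℝ)
    (h : NMPG f g γmax αmin αmax pmin x γ α p Φ)
    (γmin βmin βmax : ℝ) (hγmin : 0 < γmin) (hβmin : 0 < βmin)
    (hββ : βmin ≤ βmax) (hβmax : βmax < 1)
    (hbt : Backtrack f g αmin γmin βmin βmax x γ Φ)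
    (hLip : LocallyLipschitz (gradient f))
    (φstar : ℝ) (hΦlim : Tendsto Φ atTop (𝓝 φstar))
    (K : Set ℕ) (hKinf : K.Infinite) (hK1 : ∀ j ∈ K, 1 ≤ j)
    (xstar : X) (hconv : Tendsto x (atTop ⊓ 𝓟 K) (𝓝 xstar)) :
    ∃ γstar : ℝ, 0 < γstar ∧ (∀ j ∈ K, γstar ≤ γ j) ∧
      ∀ k : ℕ, (K ∩ Set.Icc 1 k).Nonempty →
        ∃ j ∈ K ∩ Set.Icc 1 k, ‖x j - x (j - 1)‖ / γ j ≤
          1 / Real.sqrt (Nat.card ↥(K ∩ Set.Icc 1 k)) *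
            Real.sqrt (2 * (f (x 0) + (g (x 0)).toReal - φstar) /
              (γstar * pmin * (1 - αmax))) := by
  obtain ⟨γstar, hγstar, hγK⟩ :=
    h.exists_stepsize_lower_bound hγmin hβmin hββ hbt hLip hΦlim hK1 hconv
  refine ⟨γstar, hγstar, hγK, fun k hne => ?_⟩
  have hfin : (K ∩ Set.Icc 1 k).Finite := (Set.finite_Icc 1 k).inter_of_right K
  have hmem : ∀ j, j ∈ hfin.toFinset ↔ j ∈ K ∩ Set.Icc 1 k := fun j => hfin.mem_toFinset
  obtain ⟨j, hj, hle⟩ := exists_le_of_sum_sq_le (hfin.toFinset_nonempty.mpr hne) _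
    (h.sum_sq_le hγstar hΦlim (k := k) (S := hfin.toFinset)
      (fun j hj => Finset.mem_Icc.mpr ((hmem j).mp hj).2)
      (fun j hj => hγK j ((hmem j).mp hj).1))
  refine ⟨j, (hmem j).mp hj, ?_⟩
  rwa [Nat.card_coe_set_eq, Set.ncard_eq_toFinset_card _ hfin]
end

section
/- Let X be a finite-dimensional real inner product space, let f : X → ℝ be continuously differentiable with ∇f locally Lipschitz continuous (every point of X has a neighborhood on which ∇f is Lipschitz), let g : X → ℝ ∪ {∞} be proper, lower semicontinuous and prox-bounded (g + (1/(2γ))‖·‖² is bounded below on X for some γ > 0), and set φ := f + g. Fix x ∈ X with g(x) < ∞ and α ∈ (0,1). Then there exists γ̄ > 0 such that for every γ ∈ (0, γ̄] and every minimizer x̄ over X of z ↦ g(z) + ⟨∇f(x), z − x⟩ + (1/(2γ))‖z − x‖², the sufficient decrease condition φ(x̄) ≤ φ(x) − ((1 − α)/(2γ))‖x̄ − x‖² holds. (Consequently, a backtracking line search that halves the stepsize upon rejection terminates after finitely many trials.) -/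
open Filter Topology
open scoped RealInnerProductSpace

variable {X : Type*} [NormedAddCommGroup X] [InnerProductSpace ℝ X] [FiniteDimensional ℝ X]

/-- A quadratic upper bound for `f` around a point near which its gradient is Lipschitz. -/
theorem exists_forall_le_quadratic_of_locallyLipschitz_gradient {f : X → ℝ}
    (hf : Differentiable ℝ f) (hLip : LocallyLipschitz (gradient f)) (x : X) :
    ∃ K r : ℝ, 0 ≤ K ∧ 0 < r ∧ ∀ y, ‖y - x‖ ≤ r →
      f y ≤ f x + ⟪gradient f x, y - x⟫ + K * ‖y - x‖ ^ 2 := by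
  obtain ⟨K, t, ht, hK⟩ := hLip x
  obtain ⟨r, hr, hball⟩ := Metric.nhds_basis_closedBall.mem_iff.1 ht
  refine ⟨K, r, K.2, hr, fun y hy => ?_⟩
  have hbound : ∀ z ∈ Metric.closedBall x ‖y - x‖,
      ‖fderiv ℝ f z - InnerProductSpace.toDual ℝ X (gradient f x)‖ ≤ K * ‖y - x‖ := by
    intro z hz
    have hzr : z ∈ t := hball (Metric.closedBall_subset_closedBall hy hz)
    have hxt : x ∈ t := hball (Metric.mem_closedBall_self hr.le)
    have hfd : fderiv ℝ f z = InnerProductSpace.toDual ℝ X (gradient f z) := by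
      simp [gradient]
    rw [hfd, ← map_sub, LinearIsometryEquiv.norm_map]
    have h := hK.dist_le_mul z hzr x hxt
    rw [dist_eq_norm] at h
    exact h.trans (mul_le_mul_of_nonneg_left (Metric.mem_closedBall.1 hz) K.2)
  have h := (convex_closedBall x ‖y - x‖).norm_image_sub_le_of_norm_hasFDerivWithin_le'
    (fun z _ => (hf z).hasFDerivAt.hasFDerivWithinAt) hbound
    (Metric.mem_closedBall_self (norm_nonneg _))
    (Metric.mem_closedBall.2 (dist_eq_norm y x).le)
  rw [InnerProductSpace.toDual_apply_apply, Real.norm_eq_abs] at h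
  linarith [le_abs_self (f y - f x - ⟪gradient f x, y - x⟫),
    mul_assoc (K : ℝ) ‖y - x‖ ‖y - x‖, pow_two ‖y - x‖]

/-- A displacement satisfying the prox inequality and a quadratic lower bound is small
for small stepsizes, where `c` plays the role of the reciprocal `1 / (2γ)`. -/
theorem norm_sub_le_of_prox_inequality {E : Type*} [NormedAddCommGroup E]
    [InnerProductSpace ℝ E] {v x y : E} {a b m γ₀ r c : ℝ} (hγ₀ : 0 < γ₀) (hr : 0 < r)
    (hprox : b + (⟪v, y - x⟫ + c * ‖y - x‖ ^ 2) ≤ a)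
    (hlow : m ≤ b + ‖y‖ ^ 2 / (2 * γ₀))
    (hc : 1 / γ₀ + 1 + (|a - m| + ‖x‖ ^ 2 / γ₀ + ‖v‖ ^ 2 + 1) / r ^ 2 ≤ c) :
    ‖y - x‖ ≤ r := by
  set C := |a - m| + ‖x‖ ^ 2 / γ₀ + ‖v‖ ^ 2 + 1 with hC
  have hCpos : 0 < C := by positivity
  have hinner : -(‖v‖ * ‖y - x‖) ≤ ⟪v, y - x⟫ := neg_le_of_abs_le (abs_real_inner_le_norm v _)
  have hy : ‖y‖ ^ 2 / (2 * γ₀) ≤ 1 / γ₀ * ‖y - x‖ ^ 2 + ‖x‖ ^ 2 / γ₀ := by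
    have hle : ‖y‖ ≤ ‖y - x‖ + ‖x‖ := by simpa using norm_add_le (y - x) x
    have hsq : ‖y‖ ^ 2 ≤ 2 * (‖y - x‖ ^ 2 + ‖x‖ ^ 2) := by
      nlinarith [norm_nonneg y, sq_nonneg (‖y - x‖ - ‖x‖)]
    calc ‖y‖ ^ 2 / (2 * γ₀) ≤ 2 * (‖y - x‖ ^ 2 + ‖x‖ ^ 2) / (2 * γ₀) := by gcongr
      _ = _ := by field_simp
  have hd := mul_le_mul_of_nonneg_right hc (sq_nonneg ‖y - x‖)
  have hkey : C / r ^ 2 * ‖y - x‖ ^ 2 ≤ C := by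
    nlinarith [le_abs_self (a - m), sq_nonneg (‖v‖ - ‖y - x‖), sq_nonneg ‖v‖,
      sq_nonneg ‖y - x‖]
  rw [div_mul_eq_mul_div, div_le_iff₀ (by positivity)] at hkey
  exact (sq_le_sq₀ (norm_nonneg _) hr.le).1 (le_of_mul_le_mul_left hkey hCpos)

theorem stmt_16 (f : X → ℝ) (g : X → EReal)
    (hf : ContDiff ℝ 1 f) (hLip : LocallyLipschitz (gradient f))
    (hg_nebot : ∀ z, g z ≠ ⊥) (hg_proper : ∃ z, g z ≠ ⊤)
    (hg_lsc : LowerSemicontinuous g)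
    (hg_proxbdd : ∃ γ₀ : ℝ, 0 < γ₀ ∧ ∃ m : ℝ, ∀ z,
      (m : EReal) ≤ g z + ((‖z‖ ^ 2 / (2 * γ₀) : ℝ) : EReal))
    (x : X) (hx : g x ≠ ⊤) (α : ℝ) (hα0 : 0 < α) (hα1 : α < 1) :
    ∃ γbar : ℝ, 0 < γbar ∧ ∀ γ' : ℝ, 0 < γ' → γ' ≤ γbar → ∀ xbar : X,
      ProxMin g (gradient f x) x γ' xbar →
      phiE f g xbar ≤ phiE f g x - (((1 - α) / (2 * γ') * ‖xbar - x‖ ^ 2 : ℝ) : EReal) := by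
  obtain ⟨γ₀, hγ₀, m, hm⟩ := hg_proxbdd
  obtain ⟨K, r, hK, hr, hquad⟩ := exists_forall_le_quadratic_of_locallyLipschitz_gradient
    (hf.differentiable one_ne_zero) hLip x
  obtain ⟨a, ha⟩ : ∃ a : ℝ, g x = a := ⟨_, (EReal.coe_toReal hx (hg_nebot x)).symm⟩
  set B := 1 / γ₀ + 1 + (|a - m| + ‖x‖ ^ 2 / γ₀ + ‖gradient f x‖ ^ 2 + 1) / r ^ 2
  have hBpos : 0 < B := by positivity
  refine ⟨1 / (2 * (B + K / α)), by positivity, fun γ hγ hγle y hy => ?_⟩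
  have hc : B + K / α ≤ 1 / (2 * γ) := by
    rw [le_div_iff₀ (by positivity)] at hγle ⊢
    linarith
  have hprox := hy x
  have hgy : g y ≠ ⊤ := by
    intro h
    rw [h, ha, EReal.top_add_coe, ← EReal.coe_add] at hprox
    exact EReal.coe_ne_top _ (top_le_iff.1 hprox)
  obtain ⟨b, hb⟩ : ∃ b : ℝ, g y = b := ⟨_, (EReal.coe_toReal hgy (hg_nebot y)).symm⟩
  have hlow := hm y
  rw [ha, hb, ← EReal.coe_add, ← EReal.coe_add, EReal.coe_le_coe_iff] at hprox
  rw [hb, ← EReal.coe_add, EReal.coe_le_coe_iff] at hlow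
  replace hprox : b + (⟪gradient f x, y - x⟫ + 1 / (2 * γ) * ‖y - x‖ ^ 2) ≤ a := by
    simpa [div_eq_inv_mul] using hprox
  have hKα : K ≤ α * (1 / (2 * γ)) := by
    rw [← div_le_iff₀' hα0]
    linarith
  have hBc : B ≤ 1 / (2 * γ) := by linarith [div_nonneg hK hα0.le]
  have hdesc := hquad y (norm_sub_le_of_prox_inequality hγ₀ hr hprox hlow hBc)
  rw [phiE, phiE, ha, hb, ← EReal.coe_add, ← EReal.coe_add, ← EReal.coe_sub,
    EReal.coe_le_coe_iff, div_eq_mul_one_div]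
  linarith [mul_le_mul_of_nonneg_right hKα (sq_nonneg ‖y - x‖)]
end

section
/- Let X be a finite-dimensional real inner product space, g : X → ℝ ∪ {∞} proper, and let x, v ∈ X and 0 < γ < σ. Suppose x_γ is a minimizer over X of z ↦ g(z) + ⟨v, z − x⟩ + (1/(2γ))‖z − x‖² and x_σ is a minimizer over X of z ↦ g(z) + ⟨v, z − x⟩ + (1/(2σ))‖z − x‖². Then ‖x_γ − x‖ ≤ ‖x_σ − x‖, i.e., the displacement of the proximal gradient step is nondecreasing in the stepsize. -/
open Filter Topology
open scoped RealInnerProductSpace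

variable {X : Type*} [NormedAddCommGroup X] [InnerProductSpace ℝ X] [FiniteDimensional ℝ X]

/-- A proximal gradient step on a proper function lands in its effective domain. -/
theorem ProxMin.ne_top {E : Type*} [NormedAddCommGroup E] [InnerProductSpace ℝ E]
    {g : E → EReal} {v x y : E} {γ : ℝ} (h : ProxMin g v x γ y) (hg : ∃ z, g z ≠ ⊤) : g y ≠ ⊤ := by
  obtain ⟨z, hz⟩ := hg
  intro hy
  have hle := h z
  rw [hy, EReal.top_add_coe, top_le_iff] at hle
  exact EReal.add_ne_top hz (EReal.coe_ne_top _) hle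

theorem stmt_17 (g : X → EReal)
    (hg_nebot : ∀ z, g z ≠ ⊥) (hg_proper : ∃ z, g z ≠ ⊤)
    (x v : X) (γ σ : ℝ) (hγ : 0 < γ) (hγσ : γ < σ)
    (xγ xσ : X) (h1 : ProxMin g v x γ xγ) (h2 : ProxMin g v x σ xσ) :
    ‖xγ - x‖ ≤ ‖xσ - x‖ := by
  have hγ_top := h1.ne_top hg_proper
  have hσ_top := h2.ne_top hg_proper
  have hle₁ := h1 xσ
  have hle₂ := h2 xγ
  rw [← EReal.coe_toReal hγ_top (hg_nebot xγ), ← EReal.coe_toReal hσ_top (hg_nebot xσ)]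
    at hle₁ hle₂
  norm_cast at hle₁ hle₂
  have hinv : 1 / (2 * σ) < 1 / (2 * γ) :=
    one_div_lt_one_div_of_lt (by positivity) (by linarith)
  rw [div_eq_mul_one_div (‖xγ - x‖ ^ 2), div_eq_mul_one_div (‖xσ - x‖ ^ 2)] at hle₁ hle₂
  refine (sq_le_sq₀ (norm_nonneg _) (norm_nonneg _)).mp ?_
  refine le_of_mul_le_mul_right ?_ (sub_pos.mpr hinv)
  linarith
end
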